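/- Let $N \ge 2$, $\alpha > 1$, nonnegative weights $\tilde\gamma_j$ with $\gamma_u = \prod_{j\in u}\tilde\gamma_j$, let $g^* \in \mathcal{Z}_N^d$, let $1/\alpha < \lambda \le 1$, and let $\mathcal{E} \subsetneq \mathcal{Z}_N$. Set $c = \varphi(N)/(\varphi(N)-|\mathcal{E}|)$ and $\overline{\kappa} = \frac{1}{\varphi(N)}\sum_{\ell\in\mathcal{Z}_N} \kappa_{N,d+1,\alpha\lambda,\gamma^{\lambda}}(\ell)$. Then there exists $g \in \mathcal{Z}_N \setminus \mathcal{E}$ such that $$\big(\kappa_{N,d+1,\alpha,\gamma}(g)\big)^{\lambda} \le c\,\overline{\kappa}.$$ -/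

import Mathlib

open Finset
open scoped Classical

/-- The Riemann zeta function `ζ(x) = ∑_{h=1}^∞ h^{-x}` as a real sum. -/
noncomputable def zetaR (x : ℝ) : ℝ := ∑' n : ℕ, ((n : ℝ) + 1) ^ (-x)

/-- `Z_N = {k ∈ {1,…,N-1} : gcd(k,N) = 1}` (for `N ≥ 2` the element `0` is
automatically excluded since `gcd(0,N) = N ≠ 1`). -/
def ZN (N : ℕ) : Finset ℕ := (Finset.range N).filter (fun k => Nat.Coprime k N)

/-- `r_α(γ,h) = γ_{u(h)} ∏_{j ∈ u(h)} |h_j|^{-α}` with product weights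
`γ_u = ∏_{j∈u} γ̃_j`; coordinate `j : Fin d` corresponds to index `j+1`. -/
noncomputable def rpw {d : ℕ} (α : ℝ) (γ : ℕ → ℝ) (h : Fin d → ℤ) : ℝ :=
  ∏ j ∈ Finset.univ.filter (fun j : Fin d => h j ≠ 0), (γ ((j : ℕ) + 1) * |(h j : ℝ)| ^ (-α))

/-- The squared worst-case error
`e²(g) = ∑_{h ∈ ℤ^d \ {0}, h·g ≡ 0 (mod N)} r_α(γ,h)`. -/
noncomputable def err2 {d : ℕ} (N : ℕ) (α : ℝ) (γ : ℕ → ℝ) (g : Fin d → ℕ) : ℝ :=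
  ∑' h : Fin d → ℤ, if h ≠ 0 ∧ ((N : ℤ) ∣ ∑ j, h j * (g j : ℤ)) then rpw α γ h else 0

/-- `θ_{N,d+1,α,γ}(g) = ∑_{h ∈ ℤ^{d+1}, h_{d+1} ≠ 0, h·(g*,g) ≡ 0 (mod N)} r_α(γ,h)`. -/
noncomputable def theta {d : ℕ} (N : ℕ) (α : ℝ) (γ : ℕ → ℝ) (gs : Fin d → ℕ) (g : ℕ) : ℝ :=
  ∑' h : Fin (d + 1) → ℤ,
    if h (Fin.last d) ≠ 0 ∧ ((N : ℤ) ∣ ∑ j, h j * ((Fin.snoc gs g : Fin (d + 1) → ℕ) j : ℤ))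
    then rpw α γ h else 0

/-- `κ_{N,d+1,α,γ}(g) = ∑_{h_{d+1} ∈ ℤ, N ∤ h_{d+1}} ∑_{h ∈ ℤ^d, h·g* ≡ -h_{d+1} g (mod N)}
|h_{d+1}|^{-α} r_α(γ,h)`, encoded with `p = (h_{d+1}, h)`. -/
noncomputable def kappa {d : ℕ} (N : ℕ) (α : ℝ) (γ : ℕ → ℝ) (gs : Fin d → ℕ) (g : ℕ) : ℝ :=
  ∑' p : ℤ × (Fin d → ℤ),
    if ¬ ((N : ℤ) ∣ p.1) ∧ ((N : ℤ) ∣ (∑ j, p.2 j * (gs j : ℤ) + p.1 * (g : ℤ)))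
    then |(p.1 : ℝ)| ^ (-α) * rpw α γ p.2 else 0

theorem aux_summable_pi (d : ℕ) (f : Fin d → ℤ → ℝ) (hf0 : ∀ j n, 0 ≤ f j n)
    (hf : ∀ j, Summable (f j)) : Summable (fun h : Fin d → ℤ => ∏ j, f j (h j)) := by
  induction d with
  | zero => exact Summable.of_finite
  | succ d ih =>
    have h1 := ih (fun j => f j.succ) (fun j n => hf0 _ n) (fun j => hf _)
    have h2 := (hf 0).mul_of_nonneg h1 (fun n => hf0 0 n)
      (fun h => Finset.prod_nonneg (fun j _ => hf0 _ _))
    rw [← (Fin.consEquiv (fun _ : Fin (d + 1) => ℤ)).summable_iff]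
    refine h2.congr (fun p => ?_)
    simp [Fin.consEquiv, Fin.prod_univ_succ]

theorem aux_rpow_add {a b p : ℝ} (ha : 0 ≤ a) (hb : 0 ≤ b) (hp : 0 ≤ p) (hp1 : p ≤ 1) :
    (a + b) ^ p ≤ a ^ p + b ^ p := by
  lift a to NNReal using ha
  lift b to NNReal using hb
  exact_mod_cast NNReal.rpow_add_le_add_rpow a b hp hp1

theorem aux_rpow_sum {ι : Type*} (s : Finset ι) (f : ι → ℝ) (hf : ∀ i, 0 ≤ f i) {p : ℝ}
    (hp : 0 < p) (hp1 : p ≤ 1) : (∑ i ∈ s, f i) ^ p ≤ ∑ i ∈ s, f i ^ p := by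
  induction s using Finset.induction_on with
  | empty => simp [Real.zero_rpow hp.ne']
  | insert a s ha ih =>
    rw [Finset.sum_insert ha, Finset.sum_insert ha]
    have := aux_rpow_add (hf a) (Finset.sum_nonneg (fun i (_ : i ∈ s) => hf i)) hp.le hp1
    linarith

theorem aux_rpow_tsum {ι : Type*} (f : ι → ℝ) (hf : ∀ i, 0 ≤ f i) {p : ℝ}
    (hp : 0 < p) (hp1 : p ≤ 1) (hs : Summable (fun i => f i ^ p)) :
    (∑' i, f i) ^ p ≤ ∑' i, f i ^ p := by
  by_cases h : Summable f
  · refine le_of_tendsto (h.hasSum.rpow_const (Or.inr hp.le)) (Filter.Eventually.of_forall ?_)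
    intro s
    exact (aux_rpow_sum s f hf hp hp1).trans
      (hs.sum_le_tsum s (fun i _ => Real.rpow_nonneg (hf i) p))
  · rw [tsum_eq_zero_of_not_summable h, Real.zero_rpow hp.ne']
    exact tsum_nonneg (fun i => Real.rpow_nonneg (hf i) p)

theorem aux_rpw_nonneg {d : ℕ} (α : ℝ) (γ : ℕ → ℝ) (hγ : ∀ j, 0 ≤ γ j) (h : Fin d → ℤ) :
    0 ≤ rpw α γ h :=
  Finset.prod_nonneg (fun j _ => mul_nonneg (hγ _) (Real.rpow_nonneg (abs_nonneg _) _))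

theorem aux_summable_rpw (d : ℕ) (α : ℝ) (hα : 1 < α) (γ : ℕ → ℝ) (hγ : ∀ j, 0 ≤ γ j) :
    Summable (fun h : Fin d → ℤ => rpw α γ h) := by
  have := aux_summable_pi d
    (fun j n => if n ≠ 0 then γ ((j : ℕ) + 1) * |(n : ℝ)| ^ (-α) else 1) ?_ ?_
  · refine this.congr (fun h => ?_)
    rw [rpw, Finset.prod_filter]
  · intro j n
    split_ifs
    · exact mul_nonneg (hγ _) (Real.rpow_nonneg (abs_nonneg _) _)
    · exact zero_le_one
  · intro j
    have h1 := (Real.summable_abs_int_rpow hα).mul_left (γ ((j : ℕ) + 1))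
    have h2 : Summable (fun n : ℤ => if n = 0 then (1 : ℝ) else 0) :=
      summable_of_ne_finset_zero (s := {0}) (fun n hn => by simp_all)
    refine (h1.add h2).congr (fun n => ?_)
    by_cases hn : n = 0
    · subst hn
      simp [Real.zero_rpow (by linarith : -α ≠ 0)]
    · simp [hn]

theorem aux_rpw_rpow {d : ℕ} (α p : ℝ) (γ : ℕ → ℝ) (hγ : ∀ j, 0 ≤ γ j) (h : Fin d → ℤ) :
    rpw α γ h ^ p = rpw (α * p) (fun j => γ j ^ p) h := by
  rw [rpw, rpw, ← Real.finsetProd_rpow _ _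
    (fun j _ => mul_nonneg (hγ _) (Real.rpow_nonneg (abs_nonneg _) _))]
  refine Finset.prod_congr rfl (fun j _ => ?_)
  rw [Real.mul_rpow (hγ _) (Real.rpow_nonneg (abs_nonneg _) _), ← Real.rpow_mul (abs_nonneg _),
    neg_mul]

theorem aux_kappa_rpow {d : ℕ} (N : ℕ) (α : ℝ) (γ : ℕ → ℝ) (hγ : ∀ j, 0 ≤ γ j)
    (gs : Fin d → ℕ) (g : ℕ) (p : ℝ) (hp : 0 < p) (hp1 : p ≤ 1) (hαp : 1 < α * p) :
    kappa N α γ gs g ^ p ≤ kappa N (α * p) (fun j => γ j ^ p) gs g := by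
  unfold kappa
  have hγ' : ∀ j, 0 ≤ γ j ^ p := fun j => Real.rpow_nonneg (hγ j) p
  have key : ∀ q : ℤ × (Fin d → ℤ),
      (if ¬ ((N : ℤ) ∣ q.1) ∧ ((N : ℤ) ∣ (∑ j, q.2 j * (gs j : ℤ) + q.1 * (g : ℤ)))
        then |(q.1 : ℝ)| ^ (-α) * rpw α γ q.2 else 0) ^ p =
      if ¬ ((N : ℤ) ∣ q.1) ∧ ((N : ℤ) ∣ (∑ j, q.2 j * (gs j : ℤ) + q.1 * (g : ℤ)))
        then |(q.1 : ℝ)| ^ (-(α * p)) * rpw (α * p) (fun j => γ j ^ p) q.2 else 0 := by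
    intro q
    split_ifs
    · rw [Real.mul_rpow (Real.rpow_nonneg (abs_nonneg _) _) (aux_rpw_nonneg α γ hγ _),
        ← Real.rpow_mul (abs_nonneg _), neg_mul, aux_rpw_rpow α p γ hγ]
    · exact Real.zero_rpow hp.ne'
  rw [← tsum_congr key]
  refine aux_rpow_tsum _ (fun q => ?_) hp hp1 ?_
  · split_ifs
    · exact mul_nonneg (Real.rpow_nonneg (abs_nonneg _) _) (aux_rpw_nonneg α γ hγ _)
    · exact le_rfl
  · have hs := (Real.summable_abs_int_rpow hαp).mul_of_nonneg
      (aux_summable_rpw d (α * p) hαp (fun j => γ j ^ p) hγ')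
      (fun n => Real.rpow_nonneg (abs_nonneg _) _) (fun h => aux_rpw_nonneg _ _ hγ' h)
    refine Summable.of_nonneg_of_le (fun q => ?_) (fun q => ?_) hs
    · rw [key]
      split_ifs
      · exact mul_nonneg (Real.rpow_nonneg (abs_nonneg _) _) (aux_rpw_nonneg _ _ hγ' _)
      · exact le_rfl
    · rw [key]
      split_ifs
      · exact le_rfl
      · exact mul_nonneg (Real.rpow_nonneg (abs_nonneg _) _) (aux_rpw_nonneg _ _ hγ' _)

theorem aux_kappa_nonneg {d : ℕ} (N : ℕ) (α : ℝ) (γ : ℕ → ℝ) (hγ : ∀ j, 0 ≤ γ j)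
    (gs : Fin d → ℕ) (g : ℕ) : 0 ≤ kappa N α γ gs g := by
  refine tsum_nonneg (fun q => ?_)
  split_ifs
  · exact mul_nonneg (Real.rpow_nonneg (abs_nonneg _) _) (aux_rpw_nonneg _ _ hγ _)
  · exact le_rfl

theorem aux_card_ZN (N : ℕ) : (ZN N).card = N.totient := by
  rw [Nat.totient_eq_card_coprime, ZN]
  simp only [Nat.coprime_comm]

theorem exists_good_component_outside_exclusions (N : ℕ) (hN : 2 ≤ N) (α : ℝ) (hα : 1 < α)
    (γ : ℕ → ℝ) (hγ : ∀ j, 0 ≤ γ j) (d : ℕ) (gs : Fin d → ℕ)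
    (hgs : ∀ j, gs j ∈ ZN N) (lam : ℝ) (hlam1 : 1 / α < lam) (hlam2 : lam ≤ 1)
    (E : Finset ℕ) (hE : E ⊂ ZN N) :
    ∃ g ∈ ZN N \ E,
      kappa N α γ gs g ^ lam
        ≤ (N.totient : ℝ) / ((N.totient : ℝ) - (E.card : ℝ))
          * ((1 / (N.totient : ℝ)) * ∑ ℓ ∈ ZN N, kappa N (α * lam) (fun j => γ j ^ lam) gs ℓ) := by
  have hα0 : 0 < α := by linarith
  have hlam0 : 0 < lam := lt_trans (by positivity) hlam1
  have hαl : 1 < α * lam := by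
    rw [div_lt_iff₀ hα0] at hlam1
    linarith
  have hcard : ((ZN N \ E).card : ℝ) = (N.totient : ℝ) - (E.card : ℝ) := by
    rw [Finset.cast_card_sdiff hE.1, aux_card_ZN]
  have hne : (ZN N \ E).Nonempty := Finset.sdiff_nonempty.mpr hE.2
  have hpos : 0 < (N.totient : ℝ) - (E.card : ℝ) := by
    rw [← hcard]
    exact_mod_cast hne.card_pos
  have hφ : (N.totient : ℝ) ≠ 0 := by
    have : 0 < N.totient := Nat.totient_pos.mpr (by omega)
    positivity
  set S := ∑ ℓ ∈ ZN N, kappa N (α * lam) (fun j => γ j ^ lam) gs ℓ with hS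
  have hR : (N.totient : ℝ) / ((N.totient : ℝ) - (E.card : ℝ)) * ((1 / (N.totient : ℝ)) * S)
      = S / ((N.totient : ℝ) - (E.card : ℝ)) := by
    field_simp
  rw [hR]
  refine Finset.exists_le_of_sum_le hne ?_
  rw [Finset.sum_const, nsmul_eq_mul, hcard, mul_div_cancel₀ _ hpos.ne']
  calc ∑ g ∈ ZN N \ E, kappa N α γ gs g ^ lam
      ≤ ∑ g ∈ ZN N \ E, kappa N (α * lam) (fun j => γ j ^ lam) gs g :=
        Finset.sum_le_sum (fun g _ => aux_kappa_rpow N α γ hγ gs g lam hlam0 hlam2 hαl)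
    _ ≤ S := Finset.sum_le_sum_of_subset_of_nonneg Finset.sdiff_subset
        (fun g _ _ => aux_kappa_nonneg N _ _ (fun j => Real.rpow_nonneg (hγ j) _) gs g)
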